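/- arXiv:2111.07450 — 4 statements merged into one kernel-verified Lean document; each statement's English description precedes it below -/
import Mathlib

section
/- (Proposition 1.) Let T ∈ ℂ^{M×N} and write T^H = [t_1, t_2, …, t_M], so t_m ∈ ℂ^N is the m-th column of T^H. Assume T has the shift-invariance structure J_1 T = J_2 T F, where F ∈ ℂ^{N×N} is invertible and J_1 = [I_{M−1}, 0_{(M−1)×1}], J_2 = [0_{(M−1)×1}, I_{M−1}]. Suppose Q ∈ ℂ^{N×N} satisfies Q t_M = 0 and Q F^H t_1 = 0. Then, with B = T^H A^{(M)} ∈ ℂ^{N×L} the beamspace matrix and Φ = Diag(e^{iω_1},…,e^{iω_L}), the restored shift invariance Q B Φ = Q F^H B holds. -/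
open Matrix Complex

/-- The steering vector `a^{(M)}(ω) ∈ ℂ^M`, with `m`-th entry `exp(i m ω)` (0-based `m`). -/
noncomputable def steer (M : ℕ) (ω : ℝ) : Fin M → ℂ :=
  fun m => Complex.exp (Complex.I * (m : ℕ) * (ω : ℂ))

/-- The Vandermonde matrix `A^{(M)} ∈ ℂ^{M×L}` whose `l`-th column is `a^{(M)}(ω l)`. -/
noncomputable def vand (M L : ℕ) (ω : Fin L → ℝ) : Matrix (Fin M) (Fin L) ℂ :=
  Matrix.of fun m l => steer M (ω l) m

/-- Proposition 1: restored shift invariance in beamspace.  If `T` has the shift-invariance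
structure `J₁ T = J₂ T F` with `F` invertible, and `Q` annihilates both the last column `t_M`
of `Tᴴ` and `Fᴴ t₁` (with `t₁` the first column of `Tᴴ`), then with `B = Tᴴ A^{(M)}` and
`Φ = Diag(e^{iω_l})` one has `Q B Φ = Q Fᴴ B`. -/
theorem stmt1 (M N L : ℕ) (hM : 2 ≤ M)
    (T : Matrix (Fin M) (Fin N) ℂ) (F Q : Matrix (Fin N) (Fin N) ℂ)
    (hF : IsUnit F) (ω : Fin L → ℝ)
    (hshift :
      (Matrix.of fun (i : Fin (M - 1)) (j : Fin M) =>
          if (j : ℕ) = (i : ℕ) then (1 : ℂ) else 0) * T =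
      (Matrix.of fun (i : Fin (M - 1)) (j : Fin M) =>
          if (j : ℕ) = (i : ℕ) + 1 then (1 : ℂ) else 0) * T * F)
    (hQM : Q *ᵥ (fun n => star (T ⟨M - 1, by omega⟩ n)) = 0)
    (hQ1 : Q *ᵥ (Fᴴ *ᵥ fun n => star (T ⟨0, by omega⟩ n)) = 0) :
    Q * (Tᴴ * vand M L ω) *
        Matrix.diagonal (fun l => Complex.exp (Complex.I * (ω l : ℂ))) =
      Q * Fᴴ * (Tᴴ * vand M L ω) := by
  obtain ⟨K, rfl⟩ : ∃ K, M = K + 1 := ⟨M - 1, by omega⟩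
  have hrow (i : Fin K) (n : Fin N) : T i.castSucc n = (T * F) i.succ n := by
    have h := congrFun₂ hshift i n
    rw [Matrix.mul_assoc, Matrix.mul_apply, Matrix.mul_apply,
      Finset.sum_eq_single i.castSucc, Finset.sum_eq_single i.succ] at h
    · simpa using h
    · intro j _ hj
      have : (j : ℕ) ≠ i + 1 := fun h' => hj (Fin.ext h')
      simp [this]
    · simp
    · intro j _ hj
      have : (j : ℕ) ≠ i := fun h' => hj (Fin.ext h')
      simp [this]
    · simp
  have hlast (j : Fin N) : (Q * Tᴴ) j (Fin.last K) = 0 := congrFun hQM j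
  have hzero (j : Fin N) : (Q * (T * F)ᴴ) j 0 = 0 := by
    rw [Matrix.conjTranspose_mul]
    exact congrFun hQ1 j
  have hsucc (j : Fin N) (i : Fin K) :
      (Q * (T * F)ᴴ) j i.succ = (Q * Tᴴ) j i.castSucc := by
    simp only [Matrix.mul_apply (M := Q), Matrix.conjTranspose_apply, hrow]
  rw [← Matrix.mul_assoc Q, ← Matrix.mul_assoc (Q * Fᴴ), Matrix.mul_assoc Q Fᴴ,
    ← Matrix.conjTranspose_mul]
  ext j l
  rw [Matrix.mul_diagonal, Matrix.mul_apply, Matrix.mul_apply, Fin.sum_univ_castSucc,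
    Fin.sum_univ_succ, hlast, hzero, zero_mul, zero_mul, add_zero, zero_add, Finset.sum_mul]
  refine Finset.sum_congr rfl fun i _ => ?_
  rw [hsucc, mul_assoc]
  simp only [vand, steer, Matrix.of_apply, ← Complex.exp_add, Fin.val_castSucc, Fin.val_succ]
  push_cast
  ring_nf
end

section
/- (Proposition 2 of the paper, restored shift invariance for the Khatri–Rao factor matrix.) Let L, K_5 ∈ ℕ, let ω_{l,n} ∈ ℝ for l = 1,…,L and n = 1,…,5, and let Φ_n = Diag(e^{iω_{1,n}},…,e^{iω_{L,n}}). Let B_n ∈ ℂ^{N_n×L} for n = 1,…,4 and suppose matrices L_{n,1}, L_{n,2} ∈ ℂ^{N_n×N_n} satisfy L_{n,1} B_n Φ_n = L_{n,2} B_n for n = 1,…,4. Let A_5^{(K_5)} ∈ ℂ^{K_5×L} be the Vandermonde matrix with frequencies ω_{l,5}, and set P = B_1 ⊙ B_2 ⊙ B_3 ⊙ B_4 ⊙ A_5^{(K_5)}. Then: (i) for each n ∈ {1,2,3,4}, (I_{N_1} ⊗ ⋯ ⊗ L_{n,1} ⊗ ⋯ ⊗ I_{N_4} ⊗ I_{K_5})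 P Φ_n = (I_{N_1} ⊗ ⋯ ⊗ L_{n,2} ⊗ ⋯ ⊗ I_{N_4} ⊗ I_{K_5}) P, where L_{n,i} occupies the n-th Kronecker slot; and (ii) with J̄_{5,1} = [I_{K_5−1}, 0] and J̄_{5,2} = [0, I_{K_5−1}], (I_{N_1} ⊗ I_{N_2} ⊗ I_{N_3} ⊗ I_{N_4} ⊗ J̄_{5,1}) P Φ_5 = (I_{N_1} ⊗ I_{N_2} ⊗ I_{N_3} ⊗ I_{N_4} ⊗ J̄_{5,2}) P. -/
open Matrix Complex
open scoped Kronecker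

/-- The Khatri–Rao (column-wise Kronecker) product. -/
def khatriRao {m n L : Type*} (A : Matrix m L ℂ) (B : Matrix n L ℂ) :
    Matrix (m × n) L ℂ :=
  Matrix.of fun p l => A p.1 l * B p.2 l

/-- Five-factor Khatri–Rao product (iterated, lexicographic index ordering). -/
def kr5 {N1 N2 N3 N4 N5 L : Type*} (B1 : Matrix N1 L ℂ) (B2 : Matrix N2 L ℂ)
    (B3 : Matrix N3 L ℂ) (B4 : Matrix N4 L ℂ) (B5 : Matrix N5 L ℂ) :
    Matrix (N1 × N2 × N3 × N4 × N5) L ℂ :=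
  khatriRao B1 (khatriRao B2 (khatriRao B3 (khatriRao B4 B5)))

/-- The diagonal phase matrix `Φ = Diag(e^{iω₁},…,e^{iω_L})`. -/
noncomputable def phase {L : ℕ} (w : Fin L → ℝ) : Matrix (Fin L) (Fin L) ℂ :=
  Matrix.diagonal fun l => Complex.exp (Complex.I * (w l : ℂ))

/-- The mixed-product property of the Kronecker and Khatri–Rao products. -/
theorem kronecker_mul_khatriRao {m n p q L : Type*} [Fintype m] [Fintype n]
    (M : Matrix p m ℂ) (N : Matrix q n ℂ) (A : Matrix m L ℂ) (B : Matrix n L ℂ) :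
    (M ⊗ₖ N) * khatriRao A B = khatriRao (M * A) (N * B) := by
  ext r l
  simp only [khatriRao, Matrix.mul_apply, kroneckerMap_apply, Matrix.of_apply,
    Fintype.sum_prod_type, Finset.sum_mul_sum]
  exact Finset.sum_congr rfl fun _ _ => Finset.sum_congr rfl fun _ _ => mul_mul_mul_comm _ _ _ _

theorem khatriRao_mul_phase_left {m n : Type*} {L : ℕ} (A : Matrix m (Fin L) ℂ)
    (B : Matrix n (Fin L) ℂ) (w : Fin L → ℝ) :
    khatriRao A B * phase w = khatriRao (A * phase w) B := by
  ext p l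
  simp only [khatriRao, phase, Matrix.mul_diagonal, Matrix.of_apply]
  ring

theorem khatriRao_mul_phase_right {m n : Type*} {L : ℕ} (A : Matrix m (Fin L) ℂ)
    (B : Matrix n (Fin L) ℂ) (w : Fin L → ℝ) :
    khatriRao A B * phase w = khatriRao A (B * phase w) := by
  ext p l
  simp only [khatriRao, phase, Matrix.mul_diagonal, Matrix.of_apply]
  ring

/-- Shift invariance of the Vandermonde matrix: deleting its last row and applying the phases
gives the same matrix as deleting its first row. -/
theorem vand_shift_invariance (K L : ℕ) (w : Fin L → ℝ) :
    (Matrix.of fun (i : Fin (K - 1)) (j : Fin K) =>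
        if (j : ℕ) = (i : ℕ) then (1 : ℂ) else 0) * vand K L w * phase w =
      (Matrix.of fun (i : Fin (K - 1)) (j : Fin K) =>
        if (j : ℕ) = (i : ℕ) + 1 then (1 : ℂ) else 0) * vand K L w := by
  ext i l
  have row (k : ℕ) (hk : k < K) :
      ∑ j : Fin K, (if (j : ℕ) = k then (1 : ℂ) else 0) * vand K L w j l =
        Complex.exp (Complex.I * k * w l) := by
    rw [Finset.sum_eq_single ⟨k, hk⟩]
    · simp [vand, steer]
    · intro j _ hj
      rw [if_neg fun h => hj (Fin.ext h), zero_mul]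
    · simp
  rw [phase, Matrix.mul_diagonal, Matrix.mul_apply, Matrix.mul_apply]
  simp only [Matrix.of_apply]
  rw [row i (by omega), row (i + 1) (by omega), ← Complex.exp_add]
  push_cast
  ring_nf

/-- Proposition 2 of the paper: restored shift invariance for the Khatri–Rao factor matrix
`P = B₁ ⊙ B₂ ⊙ B₃ ⊙ B₄ ⊙ A₅^{(K₅)}`, in each of the five modes. -/
theorem stmt4 (L K5 N1 N2 N3 N4 : ℕ) (ω : Fin 5 → Fin L → ℝ)
    (B1 : Matrix (Fin N1) (Fin L) ℂ) (B2 : Matrix (Fin N2) (Fin L) ℂ)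
    (B3 : Matrix (Fin N3) (Fin L) ℂ) (B4 : Matrix (Fin N4) (Fin L) ℂ)
    (L11 L12 : Matrix (Fin N1) (Fin N1) ℂ) (L21 L22 : Matrix (Fin N2) (Fin N2) ℂ)
    (L31 L32 : Matrix (Fin N3) (Fin N3) ℂ) (L41 L42 : Matrix (Fin N4) (Fin N4) ℂ)
    (h1 : L11 * B1 * phase (ω 0) = L12 * B1)
    (h2 : L21 * B2 * phase (ω 1) = L22 * B2)
    (h3 : L31 * B3 * phase (ω 2) = L32 * B3)
    (h4 : L41 * B4 * phase (ω 3) = L42 * B4) :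
    ((L11 ⊗ₖ ((1 : Matrix (Fin N2) (Fin N2) ℂ) ⊗ₖ ((1 : Matrix (Fin N3) (Fin N3) ℂ) ⊗ₖ
          ((1 : Matrix (Fin N4) (Fin N4) ℂ) ⊗ₖ (1 : Matrix (Fin K5) (Fin K5) ℂ))))) *
        kr5 B1 B2 B3 B4 (vand K5 L (ω 4)) * phase (ω 0) =
      (L12 ⊗ₖ ((1 : Matrix (Fin N2) (Fin N2) ℂ) ⊗ₖ ((1 : Matrix (Fin N3) (Fin N3) ℂ) ⊗ₖ
          ((1 : Matrix (Fin N4) (Fin N4) ℂ) ⊗ₖ (1 : Matrix (Fin K5) (Fin K5) ℂ))))) *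
        kr5 B1 B2 B3 B4 (vand K5 L (ω 4))) ∧
    (((1 : Matrix (Fin N1) (Fin N1) ℂ) ⊗ₖ (L21 ⊗ₖ ((1 : Matrix (Fin N3) (Fin N3) ℂ) ⊗ₖ
          ((1 : Matrix (Fin N4) (Fin N4) ℂ) ⊗ₖ (1 : Matrix (Fin K5) (Fin K5) ℂ))))) *
        kr5 B1 B2 B3 B4 (vand K5 L (ω 4)) * phase (ω 1) =
      ((1 : Matrix (Fin N1) (Fin N1) ℂ) ⊗ₖ (L22 ⊗ₖ ((1 : Matrix (Fin N3) (Fin N3) ℂ) ⊗ₖ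
          ((1 : Matrix (Fin N4) (Fin N4) ℂ) ⊗ₖ (1 : Matrix (Fin K5) (Fin K5) ℂ))))) *
        kr5 B1 B2 B3 B4 (vand K5 L (ω 4))) ∧
    (((1 : Matrix (Fin N1) (Fin N1) ℂ) ⊗ₖ ((1 : Matrix (Fin N2) (Fin N2) ℂ) ⊗ₖ (L31 ⊗ₖ
          ((1 : Matrix (Fin N4) (Fin N4) ℂ) ⊗ₖ (1 : Matrix (Fin K5) (Fin K5) ℂ))))) *
        kr5 B1 B2 B3 B4 (vand K5 L (ω 4)) * phase (ω 2) =
      ((1 : Matrix (Fin N1) (Fin N1) ℂ) ⊗ₖ ((1 : Matrix (Fin N2) (Fin N2) ℂ) ⊗ₖ (L32 ⊗ₖ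
          ((1 : Matrix (Fin N4) (Fin N4) ℂ) ⊗ₖ (1 : Matrix (Fin K5) (Fin K5) ℂ))))) *
        kr5 B1 B2 B3 B4 (vand K5 L (ω 4))) ∧
    (((1 : Matrix (Fin N1) (Fin N1) ℂ) ⊗ₖ ((1 : Matrix (Fin N2) (Fin N2) ℂ) ⊗ₖ
          ((1 : Matrix (Fin N3) (Fin N3) ℂ) ⊗ₖ (L41 ⊗ₖ (1 : Matrix (Fin K5) (Fin K5) ℂ))))) *
        kr5 B1 B2 B3 B4 (vand K5 L (ω 4)) * phase (ω 3) =
      ((1 : Matrix (Fin N1) (Fin N1) ℂ) ⊗ₖ ((1 : Matrix (Fin N2) (Fin N2) ℂ) ⊗ₖ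
          ((1 : Matrix (Fin N3) (Fin N3) ℂ) ⊗ₖ (L42 ⊗ₖ (1 : Matrix (Fin K5) (Fin K5) ℂ))))) *
        kr5 B1 B2 B3 B4 (vand K5 L (ω 4))) ∧
    (((1 : Matrix (Fin N1) (Fin N1) ℂ) ⊗ₖ ((1 : Matrix (Fin N2) (Fin N2) ℂ) ⊗ₖ
          ((1 : Matrix (Fin N3) (Fin N3) ℂ) ⊗ₖ ((1 : Matrix (Fin N4) (Fin N4) ℂ) ⊗ₖ
            (Matrix.of fun (i : Fin (K5 - 1)) (j : Fin K5) =>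
              if (j : ℕ) = (i : ℕ) then (1 : ℂ) else 0))))) *
        kr5 B1 B2 B3 B4 (vand K5 L (ω 4)) * phase (ω 4) =
      ((1 : Matrix (Fin N1) (Fin N1) ℂ) ⊗ₖ ((1 : Matrix (Fin N2) (Fin N2) ℂ) ⊗ₖ
          ((1 : Matrix (Fin N3) (Fin N3) ℂ) ⊗ₖ ((1 : Matrix (Fin N4) (Fin N4) ℂ) ⊗ₖ
            (Matrix.of fun (i : Fin (K5 - 1)) (j : Fin K5) =>
              if (j : ℕ) = (i : ℕ) + 1 then (1 : ℂ) else 0))))) *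
        kr5 B1 B2 B3 B4 (vand K5 L (ω 4))) := by
  simp only [kr5, kronecker_mul_khatriRao, Matrix.one_mul]
  refine ⟨?_, ?_, ?_, ?_, ?_⟩
  · rw [khatriRao_mul_phase_left, h1]
  · rw [khatriRao_mul_phase_right, khatriRao_mul_phase_left, h2]
  · rw [khatriRao_mul_phase_right, khatriRao_mul_phase_right, khatriRao_mul_phase_left, h3]
  · rw [khatriRao_mul_phase_right, khatriRao_mul_phase_right, khatriRao_mul_phase_right,
      khatriRao_mul_phase_left, h4]
  · rw [khatriRao_mul_phase_right, khatriRao_mul_phase_right, khatriRao_mul_phase_right,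
      khatriRao_mul_phase_right, vand_shift_invariance]
end

section
/- Let P ∈ ℂ^{m×L} and suppose J_1 P Φ = J_2 P for matrices J_1, J_2 ∈ ℂ^{k×m} and a diagonal matrix Φ ∈ ℂ^{L×L}. Let E ∈ ℂ^{L×L} be invertible and set U = P E^{-1}. If A := J_1 U satisfies that A^H A is invertible, then (A^H A)^{-1} A^H (J_2 U) = E Φ E^{-1}. (Thus the least-squares solution Γ = (J_1 U)^† (J_2 U) of the shift-invariance equation recovers a matrix similar to Φ via the similarity transform E.) -/
open Matrix

/-- The least-squares solution `Γ = (J₁U)†(J₂U)` of the shift-invariance equation recovers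
`E Φ E⁻¹`: if `J₁ P Φ = J₂ P`, `E` is invertible, `U = P E⁻¹` and `A = J₁ U` has `AᴴA`
invertible, then `(AᴴA)⁻¹Aᴴ(J₂U) = E Φ E⁻¹`. -/
theorem stmt7 (m k L : ℕ) (P : Matrix (Fin m) (Fin L) ℂ)
    (J1 J2 : Matrix (Fin k) (Fin m) ℂ) (d : Fin L → ℂ)
    (hshift : J1 * P * Matrix.diagonal d = J2 * P)
    (E : Matrix (Fin L) (Fin L) ℂ) (hE : IsUnit E)
    (hA : IsUnit ((J1 * (P * E⁻¹))ᴴ * (J1 * (P * E⁻¹)))) :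
    ((J1 * (P * E⁻¹))ᴴ * (J1 * (P * E⁻¹)))⁻¹ * (J1 * (P * E⁻¹))ᴴ * (J2 * (P * E⁻¹)) =
      E * Matrix.diagonal d * E⁻¹ := by
  have hEdet : IsUnit E.det := (Matrix.isUnit_iff_isUnit_det E).mp hE
  have hAdet := (Matrix.isUnit_iff_isUnit_det _).mp hA
  have hJ2 : J2 * (P * E⁻¹) = J1 * (P * E⁻¹) * (E * Matrix.diagonal d * E⁻¹) := by
    rw [← Matrix.mul_assoc J2, ← hshift]
    simp only [Matrix.mul_assoc, Matrix.nonsing_inv_mul_cancel_left _ _ hEdet]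
  rw [hJ2, Matrix.mul_assoc _⁻¹, ← Matrix.mul_assoc _ᴴ _ (E * _ * _),
    Matrix.nonsing_inv_mul_cancel_left _ _ hAdet]
end

section
/- (First-order perturbation of the pseudoinverse.) Regard the space of m×n complex matrices as a real normed vector space. Let A ∈ ℂ^{m×n} be such that A^H A is invertible, and define f(X) = (X^H X)^{-1} X^H on a neighborhood of A. Then f is (real-)Fréchet differentiable at A, with derivative in the direction ΔA given by Df(A)[ΔA] = −A^† ΔA A^† + (A^H A)^{-1} (ΔA)^H (I_m − A A^†), where A^† = (A^H A)^{-1} A^H. In particular the map ΔA ↦ Df(A)[ΔA] is ℝ-linear. -/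
open Matrix

attribute [local instance] Matrix.normedAddCommGroup Matrix.normedSpace

theorem hasFDerivAt_matrix_mul {E : Type*} [NormedAddCommGroup E] [NormedSpace ℝ E]
    {l m n : Type*} [Fintype l] [Fintype m] [Fintype n]
    {f : E → Matrix l m ℂ} {g : E → Matrix m n ℂ}
    {f' : E →L[ℝ] Matrix l m ℂ} {g' : E →L[ℝ] Matrix m n ℂ} {x : E}
    (hf : HasFDerivAt f f' x) (hg : HasFDerivAt g g' x) :
    ∃ D : E →L[ℝ] Matrix l n ℂ, HasFDerivAt (fun y => f y * g y) D x ∧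
      ∀ v, D v = f x * g' v + f' v * g x := by
  let B : Matrix l m ℂ →L[ℝ] Matrix m n ℂ →L[ℝ] Matrix l n ℂ :=
    LinearMap.toContinuousBilinearMap (mulLinearMap ℝ)
  exact ⟨_, B.hasFDerivAt_of_bilinear hf hg, fun _ => rfl⟩

theorem hasFDerivAt_ringInverse_of_finiteDimensional {R : Type*} [NormedRing R]
    [NormedAlgebra ℝ R] [FiniteDimensional ℝ R] (u : Rˣ) :
    HasFDerivAt Ring.inverse (-ContinuousLinearMap.mulLeftRight ℝ R ↑u⁻¹ ↑u⁻¹) (u : R) :=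
  have : CompleteSpace R := FiniteDimensional.complete ℝ R
  hasFDerivAt_ringInverse u

theorem hasFDerivAt_matrix_inv {n : Type*} [Fintype n] [DecidableEq n]
    {B : Matrix n n ℂ} (hB : IsUnit B) :
    ∃ D : Matrix n n ℂ →L[ℝ] Matrix n n ℂ, HasFDerivAt (fun X : Matrix n n ℂ => X⁻¹) D B ∧
      ∀ V, D V = -(B⁻¹ * V * B⁻¹) := by
  obtain ⟨u, rfl⟩ := hB
  let := Matrix.linftyOpNormedRing (n := n) (α := ℂ)
  let := Matrix.linftyOpNormedAlgebra (R := ℝ) (n := n) (α := ℂ)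
  have h := hasFDerivAt_ringInverse_of_finiteDimensional u
  simp only [nonsing_inv_eq_ringInverse]
  refine ⟨_, h, fun V => ?_⟩
  rw [Ring.inverse_unit]
  rfl

theorem hasFDerivAt_conjTranspose {m n : Type*} [Fintype m] [Fintype n] (A : Matrix m n ℂ) :
    ∃ D : Matrix m n ℂ →L[ℝ] Matrix n m ℂ,
      HasFDerivAt (fun X : Matrix m n ℂ => Xᴴ) D A ∧ ∀ V, D V = Vᴴ :=
  let L : Matrix m n ℂ →ₗ[ℝ] Matrix n m ℂ :=
    { toFun := fun X => Xᴴ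
      map_add' := conjTranspose_add
      map_smul' := fun c X => by simp [conjTranspose_smul] }
  ⟨_, (LinearMap.toContinuousLinearMap L).hasFDerivAt, fun _ => rfl⟩

/-- First-order perturbation of the pseudoinverse: `X ↦ (XᴴX)⁻¹Xᴴ` is real-Fréchet
differentiable at `A` (when `AᴴA` is invertible), with derivative
`ΔA ↦ −A†ΔA A† + (AᴴA)⁻¹(ΔA)ᴴ(I − AA†)`, which is in particular ℝ-linear. -/
theorem stmt10 (m n : ℕ) (A : Matrix (Fin m) (Fin n) ℂ)
    (hA : IsUnit (Aᴴ * A)) :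
    ∃ D : Matrix (Fin m) (Fin n) ℂ →L[ℝ] Matrix (Fin n) (Fin m) ℂ,
      HasFDerivAt (fun X : Matrix (Fin m) (Fin n) ℂ => (Xᴴ * X)⁻¹ * Xᴴ) D A ∧
      ∀ ΔA : Matrix (Fin m) (Fin n) ℂ,
        D ΔA = -(((Aᴴ * A)⁻¹ * Aᴴ) * ΔA * ((Aᴴ * A)⁻¹ * Aᴴ)) +
          (Aᴴ * A)⁻¹ * ΔAᴴ * (1 - A * ((Aᴴ * A)⁻¹ * Aᴴ)) := by
  obtain ⟨S, hS, hS_apply⟩ := hasFDerivAt_conjTranspose A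
  obtain ⟨G, hG, hG_apply⟩ := hasFDerivAt_matrix_mul hS (hasFDerivAt_id A)
  obtain ⟨J, hJ, hJ_apply⟩ := hasFDerivAt_matrix_inv hA
  obtain ⟨D, hD, hD_apply⟩ := hasFDerivAt_matrix_mul
    (HasFDerivAt.comp (f := fun X : Matrix (Fin m) (Fin n) ℂ => Xᴴ * X) A hJ hG) hS
  refine ⟨D, hD, fun V => (hD_apply V).trans ?_⟩
  have hGV : G V = Aᴴ * V + Vᴴ * A :=
    (hG_apply V).trans (congrArg (fun W => Aᴴ * V + W * A) (hS_apply V))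
  change (Aᴴ * A)⁻¹ * S V + J (G V) * Aᴴ = _
  rw [hJ_apply, hGV, hS_apply]
  simp only [Matrix.mul_add, Matrix.add_mul, Matrix.mul_sub, Matrix.neg_mul, Matrix.mul_one,
    Matrix.mul_assoc, neg_add]
  abel
end
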